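/- arXiv:1011.4571 — 2 statements merged into one kernel-verified Lean document; each statement's English description precedes it below -/
import Mathlib

section
/- (Logarithmic asymptotics of the metric coefficients, Theorem 4.1.) Let (η, λ, r, s) be a regular solution on [1,∞). Then there exists a constant C > 0 such that for every t ≥ 1 and every x ∈ ℝ: |η(t,x) + ln t| ≤ C and |λ(t,x) − ln t| ≤ C. -/
open Real Set MeasureTheory

noncomputable section

/-- Partial derivative with respect to the time variable `t`. -/
def pderivT (f : ℝ → ℝ → ℝ) (t x : ℝ) : ℝ := deriv (fun τ => f τ x) t

/-- Partial derivative with respect to the space variable `x`. -/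
def pderivX (f : ℝ → ℝ → ℝ) (t x : ℝ) : ℝ := deriv (fun y => f t y) x

/-- The time interval `[1, T)` for a (possibly infinite) final time `T ∈ (1,∞]`. -/
def timeSlab (T : EReal) : Set ℝ := {t : ℝ | 1 ≤ t ∧ (t : EReal) < T}

/-- A regular solution of the plane-symmetric Einstein–stiff fluid equations in areal
coordinates, with cosmological constant `Λ`, on a time interval `J`:
continuously differentiable functions `η, λ, r, s`, 1-periodic in the space variable,
with `r ≥ 0`, `s ≥ 0`, satisfying the evolution and constraint equations (E1)–(E5). -/
structure RegularSolution (Λ : ℝ) (J : Set ℝ) where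
  η : ℝ → ℝ → ℝ
  lam : ℝ → ℝ → ℝ
  r : ℝ → ℝ → ℝ
  s : ℝ → ℝ → ℝ
  η_c1 : ContDiffOn ℝ 1 (fun p : ℝ × ℝ => η p.1 p.2) (J ×ˢ (Set.univ : Set ℝ))
  lam_c1 : ContDiffOn ℝ 1 (fun p : ℝ × ℝ => lam p.1 p.2) (J ×ˢ (Set.univ : Set ℝ))
  r_c1 : ContDiffOn ℝ 1 (fun p : ℝ × ℝ => r p.1 p.2) (J ×ˢ (Set.univ : Set ℝ))
  s_c1 : ContDiffOn ℝ 1 (fun p : ℝ × ℝ => s p.1 p.2) (J ×ˢ (Set.univ : Set ℝ))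
  η_per : ∀ t ∈ J, ∀ x : ℝ, η t (x + 1) = η t x
  lam_per : ∀ t ∈ J, ∀ x : ℝ, lam t (x + 1) = lam t x
  r_per : ∀ t ∈ J, ∀ x : ℝ, r t (x + 1) = r t x
  s_per : ∀ t ∈ J, ∀ x : ℝ, s t (x + 1) = s t x
  r_nonneg : ∀ t ∈ J, ∀ x : ℝ, 0 ≤ r t x
  s_nonneg : ∀ t ∈ J, ∀ x : ℝ, 0 ≤ s t x
  eqE1 : ∀ t ∈ J, ∀ x : ℝ,
    Real.exp (-2 * η t x) * (2 * t * pderivT lam t x + 1) - Λ * t ^ 2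
      = 4 * Real.pi * t ^ 2 * (r t x + s t x)
  eqE2 : ∀ t ∈ J, ∀ x : ℝ,
    Real.exp (-2 * η t x) * (2 * t * pderivT η t x - 1) + Λ * t ^ 2
      = 4 * Real.pi * t ^ 2 * (r t x + s t x)
  eqE3 : ∀ t ∈ J, ∀ x : ℝ,
    pderivX η t x = -(2 * Real.pi * t * Real.exp (lam t x + η t x) * (r t x - s t x))
  eqE4 : ∀ t ∈ J, ∀ x : ℝ,
    pderivT r t x + Real.exp (η t x - lam t x) * pderivX r t x
      = -2 * (pderivT lam t x + Real.exp (η t x - lam t x) * pderivX η t x + 1 / t) * r t x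
        - 2 / t * Real.sqrt (r t x * s t x)
  eqE5 : ∀ t ∈ J, ∀ x : ℝ,
    pderivT s t x - Real.exp (η t x - lam t x) * pderivX s t x
      = -2 * (pderivT lam t x - Real.exp (η t x - lam t x) * pderivX η t x + 1 / t) * s t x
        - 2 / t * Real.sqrt (r t x * s t x)

/-- A continuous function on a time slab that is 1-periodic in space is bounded on compact time
intervals. -/
theorem exists_abs_le_of_periodic {f : ℝ → ℝ → ℝ}
    (hf : ContinuousOn (fun p : ℝ × ℝ => f p.1 p.2) (Ici (1 : ℝ) ×ˢ univ))
    (hper : ∀ t ∈ Ici (1 : ℝ), ∀ x, f t (x + 1) = f t x) (T : ℝ) :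
    ∃ B, 0 ≤ B ∧ ∀ t, 1 ≤ t → t ≤ T → ∀ x, |f t x| ≤ B := by
  obtain ⟨B, hB⟩ := (isCompact_Icc.prod isCompact_Icc).exists_bound_of_continuousOn
    (hf.mono (prod_mono (s₁ := Icc 1 T) (fun _ hτ => hτ.1)
      (subset_univ (Icc (0 : ℝ) 1))))
  refine ⟨max B 0, le_max_right _ _, fun t ht htT x => ?_⟩
  obtain ⟨y, hy, hxy⟩ := Function.Periodic.exists_mem_Ico₀ (hper t ht) one_pos x
  rw [hxy]
  exact (hB (t, y) ⟨⟨ht, htT⟩, hy.1, hy.2.le⟩).trans (le_max_left _ _)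

/-- A `C¹` function on `[1, ∞) × ℝ` is differentiable in time for `t > 1`. -/
theorem hasDerivAt_pderivT {f : ℝ → ℝ → ℝ}
    (hf : ContDiffOn ℝ 1 (fun p : ℝ × ℝ => f p.1 p.2) (Ici (1 : ℝ) ×ˢ univ))
    {t : ℝ} (ht : 1 < t) (x : ℝ) :
    HasDerivAt (fun τ => f τ x) (pderivT f t x) t := by
  have hd : DifferentiableAt ℝ (fun p : ℝ × ℝ => f p.1 p.2) (t, x) :=
    (hf.contDiffAt (prod_mem_nhds (Ici_mem_nhds ht) Filter.univ_mem)).differentiableAt (by simp)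
  have hg : DifferentiableAt ℝ (fun τ : ℝ => (τ, x)) t := by fun_prop
  exact (DifferentiableAt.comp (f := fun τ : ℝ => (τ, x))
    (g := fun p : ℝ × ℝ => f p.1 p.2) t hd hg).hasDerivAt

theorem continuousOn_time_slice {f : ℝ → ℝ → ℝ}
    (hf : ContDiffOn ℝ 1 (fun p : ℝ × ℝ => f p.1 p.2) (Ici (1 : ℝ) ×ˢ univ)) (x : ℝ) :
    ContinuousOn (fun τ => f τ x) (Ici 1) :=
  hf.continuousOn.comp (f := fun τ : ℝ => (τ, x)) (by fun_prop) (fun _ hτ => ⟨hτ, mem_univ _⟩)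

/-- Maximum principle: if `t * f` is strictly decreasing in time wherever `f` is positive and
spatially critical, then `t * f` is bounded above. -/
theorem exists_mul_le_of_pderivT_neg {f : ℝ → ℝ → ℝ}
    (hf : ContDiffOn ℝ 1 (fun p : ℝ × ℝ => f p.1 p.2) (Ici (1 : ℝ) ×ˢ univ))
    (hper : ∀ t ∈ Ici (1 : ℝ), ∀ x, f t (x + 1) = f t x)
    (hneg : ∀ t x, 1 < t → 0 < f t x → pderivX f t x = 0 → f t x + t * pderivT f t x < 0) :
    ∃ M, 0 ≤ M ∧ ∀ t, 1 ≤ t → ∀ x, t * f t x ≤ M := by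
  obtain ⟨M, hM0, hM⟩ := exists_abs_le_of_periodic hf.continuousOn hper 1
  refine ⟨M, hM0, fun T hT x => ?_⟩
  by_contra! hlt
  have hcont : ContinuousOn (fun p : ℝ × ℝ => p.1 * f p.1 p.2) (Icc 1 T ×ˢ Icc 0 1) :=
    continuousOn_fst.mul (hf.continuousOn.mono (prod_mono (fun _ hτ => hτ.1) (subset_univ _)))
  obtain ⟨⟨t, y⟩, ⟨ht, hy⟩, hmax⟩ := (isCompact_Icc.prod isCompact_Icc).exists_isMaxOn
    ⟨(1, 0), ⟨le_rfl, hT⟩, le_rfl, zero_le_one⟩ hcont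
  have hmax' : ∀ τ, 1 ≤ τ → τ ≤ T → ∀ z, τ * f τ z ≤ t * f t y := by
    intro τ h1 h2 z
    obtain ⟨w, hw, hzw⟩ := Function.Periodic.exists_mem_Ico₀ (hper τ h1) one_pos z
    rw [hzw]
    exact hmax (show (τ, w) ∈ Icc 1 T ×ˢ Icc (0 : ℝ) 1 from ⟨⟨h1, h2⟩, hw.1, hw.2.le⟩)
  simp only [mem_Icc] at ht
  have hval : M < t * f t y := hlt.trans_le (hmax' T hT le_rfl x)
  have ht1 : 1 < t := by
    rcases ht.1.lt_or_eq with h | h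
    · exact h
    · have := le_of_abs_le (hM 1 le_rfl le_rfl y)
      rw [← h, one_mul] at hval
      linarith
  have ht0 : 0 < t := by linarith
  have hpos : 0 < f t y := pos_of_mul_pos_right (hM0.trans_lt hval) ht0.le
  have hX : pderivX f t y = 0 := by
    have : IsLocalMax (fun z => f t z) y :=
      Filter.Eventually.of_forall fun z => le_of_mul_le_mul_left (hmax' t ht.1 ht.2 z) ht0
    exact this.deriv_eq_zero
  have hder : HasDerivAt (fun τ => τ * f τ y) (f t y + t * pderivT f t y) t := by
    exact ((hasDerivAt_id t).mul (hasDerivAt_pderivT hf ht1 y)).congr_deriv (by simp)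
  have hslope := (hasDerivAt_iff_tendsto_slope_left_right.1 hder).1
  have hnonneg : 0 ≤ f t y + t * pderivT f t y := by
    refine ge_of_tendsto hslope ?_
    filter_upwards [Ioo_mem_nhdsLT ht1] with τ hτ
    rw [slope_def_field]
    refine div_nonneg_of_nonpos ?_ ?_
    · have := hmax' τ hτ.1.le (hτ.2.le.trans ht.2) y
      linarith
    · linarith [hτ.2]
  exact absurd (hneg t y ht1 hpos hX) (not_lt.2 hnonneg)

namespace RegularSolution

theorem two_mul_pderivT_lam {Λ : ℝ} (sol : RegularSolution Λ (Ici 1)) {t : ℝ} (ht : 1 ≤ t)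
    (x : ℝ) : 2 * t * pderivT sol.lam t x =
      rexp (2 * sol.η t x) * (Λ * t ^ 2 + 4 * π * t ^ 2 * (sol.r t x + sol.s t x)) - 1 := by
  have h := sol.eqE1 t ht x
  have he : rexp (2 * sol.η t x) * rexp (-2 * sol.η t x) = 1 := by
    rw [← exp_add]; simp
  linear_combination rexp (2 * sol.η t x) * h - (2 * t * pderivT sol.lam t x + 1) * he

theorem two_mul_pderivT_η {Λ : ℝ} (sol : RegularSolution Λ (Ici 1)) {t : ℝ} (ht : 1 ≤ t)
    (x : ℝ) : 2 * t * pderivT sol.η t x =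
      rexp (2 * sol.η t x) * (4 * π * t ^ 2 * (sol.r t x + sol.s t x) - Λ * t ^ 2) + 1 := by
  have h := sol.eqE2 t ht x
  have he : rexp (2 * sol.η t x) * rexp (-2 * sol.η t x) = 1 := by
    rw [← exp_add]; simp
  linear_combination rexp (2 * sol.η t x) * h - (2 * t * pderivT sol.η t x - 1) * he

theorem exp_mul_pderivX_η {Λ : ℝ} (sol : RegularSolution Λ (Ici 1)) {t : ℝ} (ht : 1 ≤ t)
    (x : ℝ) : rexp (sol.η t x - sol.lam t x) * pderivX sol.η t x =
      -(2 * π * t * rexp (2 * sol.η t x) * (sol.r t x - sol.s t x)) := by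
  have he : rexp (sol.η t x - sol.lam t x) * rexp (sol.lam t x + sol.η t x)
      = rexp (2 * sol.η t x) := by
    rw [← exp_add]; ring_nf
  rw [sol.eqE3 t ht x, ← he]
  ring

theorem exists_mul_r_le {Λ : ℝ} (hΛ : 0 < Λ) (sol : RegularSolution Λ (Ici 1)) :
    ∃ M, 0 ≤ M ∧ ∀ t, 1 ≤ t → ∀ x, t * sol.r t x ≤ M := by
  refine exists_mul_le_of_pderivT_neg sol.r_c1 sol.r_per fun t x ht hr hX => ?_
  have ht0 : 0 < t := by linarith
  have h4 := sol.eqE4 t ht.le x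
  rw [hX, sol.exp_mul_pderivX_η ht.le x] at h4
  have h1 := sol.two_mul_pderivT_lam ht.le x
  have hs := sol.s_nonneg t ht.le x
  have key : sol.r t x + t * pderivT sol.r t x =
      -(rexp (2 * sol.η t x) * t ^ 2 * (Λ + 8 * π * sol.s t x) * sol.r t x)
        - 2 * √(sol.r t x * sol.s t x) := by
    have h5 : t * (1 / t) = 1 := by field_simp
    have h6 : t * (2 / t) = 2 := by field_simp
    linear_combination t * h4 - sol.r t x * h1 - 2 * sol.r t x * h5
      - √(sol.r t x * sol.s t x) * h6
  rw [key]
  have : 0 < rexp (2 * sol.η t x) * t ^ 2 * (Λ + 8 * π * sol.s t x) * sol.r t x := by positivity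
  linarith [sqrt_nonneg (sol.r t x * sol.s t x)]

theorem exists_mul_s_le {Λ : ℝ} (hΛ : 0 < Λ) (sol : RegularSolution Λ (Ici 1)) :
    ∃ M, 0 ≤ M ∧ ∀ t, 1 ≤ t → ∀ x, t * sol.s t x ≤ M := by
  refine exists_mul_le_of_pderivT_neg sol.s_c1 sol.s_per fun t x ht hs hX => ?_
  have ht0 : 0 < t := by linarith
  have h4 := sol.eqE5 t ht.le x
  rw [hX, sol.exp_mul_pderivX_η ht.le x] at h4
  have h1 := sol.two_mul_pderivT_lam ht.le x
  have hr := sol.r_nonneg t ht.le x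
  have key : sol.s t x + t * pderivT sol.s t x =
      -(rexp (2 * sol.η t x) * t ^ 2 * (Λ + 8 * π * sol.r t x) * sol.s t x)
        - 2 * √(sol.r t x * sol.s t x) := by
    have h5 : t * (1 / t) = 1 := by field_simp
    have h6 : t * (2 / t) = 2 := by field_simp
    linear_combination t * h4 - sol.s t x * h1 - 2 * sol.s t x * h5
      - √(sol.r t x * sol.s t x) * h6
  rw [key]
  have : 0 < rexp (2 * sol.η t x) * t ^ 2 * (Λ + 8 * π * sol.r t x) * sol.s t x := by positivity
  linarith [sqrt_nonneg (sol.r t x * sol.s t x)]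

/-- The energy density of the fluid decays at least like `1 / t`. -/
theorem exists_mul_density_le {Λ : ℝ} (hΛ : 0 < Λ) (sol : RegularSolution Λ (Ici 1)) :
    ∃ M, 0 ≤ M ∧ ∀ t, 1 ≤ t → ∀ x, t * (sol.r t x + sol.s t x) ≤ M := by
  obtain ⟨M, hM0, hM⟩ := sol.exists_mul_r_le hΛ
  obtain ⟨N, hN0, hN⟩ := sol.exists_mul_s_le hΛ
  exact ⟨M + N, by positivity, fun t ht x => by linarith [hM t ht x, hN t ht x]⟩

theorem hasDerivAt_mul_exp_neg_two_η {Λ : ℝ} (sol : RegularSolution Λ (Ici 1)) {t : ℝ}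
    (ht : 1 < t) (x : ℝ) :
    HasDerivAt (fun τ => τ * rexp (-2 * sol.η τ x))
      (Λ * t ^ 2 - 4 * π * t ^ 2 * (sol.r t x + sol.s t x)) t := by
  have h := (hasDerivAt_id t).mul (((hasDerivAt_pderivT sol.η_c1 ht x).const_mul (-2)).exp)
  refine h.congr_deriv ?_
  simp only [id]
  linear_combination - sol.eqE2 t ht.le x

theorem exists_exp_neg_two_η_le {Λ : ℝ} (hΛ : 0 < Λ) (sol : RegularSolution Λ (Ici 1)) :
    ∃ b, 0 < b ∧ ∀ t, 1 ≤ t → ∀ x, rexp (-2 * sol.η t x) ≤ b * t ^ 2 := by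
  obtain ⟨B, -, hB⟩ := exists_abs_le_of_periodic sol.η_c1.continuousOn sol.η_per 1
  refine ⟨rexp (2 * B) + Λ / 3, by positivity, fun t ht x => ?_⟩
  have hanti : AntitoneOn (fun τ => τ * rexp (-2 * sol.η τ x) - Λ / 3 * τ ^ 3) (Ici 1) := by
    have hd : ∀ τ : ℝ, 1 < τ → HasDerivAt (fun τ => τ * rexp (-2 * sol.η τ x) - Λ / 3 * τ ^ 3)
        (-(4 * π * τ ^ 2 * (sol.r τ x + sol.s τ x))) τ := fun τ hτ =>
      ((sol.hasDerivAt_mul_exp_neg_two_η hτ x).sub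
        ((hasDerivAt_pow 3 τ).const_mul (Λ / 3))).congr_deriv (by push_cast; ring)
    refine antitoneOn_of_deriv_nonpos (convex_Ici 1) ?_ ?_ ?_
    · have := continuousOn_time_slice sol.η_c1 x
      fun_prop
    · rw [interior_Ici]
      exact fun τ hτ => (hd τ hτ).differentiableAt.differentiableWithinAt
    · rw [interior_Ici]
      intro τ hτ
      rw [(hd τ hτ).deriv]
      have h1 := sol.r_nonneg τ (mem_Ici.2 (le_of_lt hτ)) x
      have h2 := sol.s_nonneg τ (mem_Ici.2 (le_of_lt hτ)) x
      have : 0 ≤ 4 * π * τ ^ 2 * (sol.r τ x + sol.s τ x) := by positivity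
      linarith
  have h := hanti (mem_Ici.2 le_rfl) ht ht
  simp only [one_mul, one_pow, mul_one] at h
  have h1 : rexp (-2 * sol.η 1 x) ≤ rexp (2 * B) :=
    exp_le_exp.2 (by linarith [neg_le_of_abs_le (hB 1 le_rfl le_rfl x)])
  have ht0 : 0 < t := by linarith
  have h3 : 1 ≤ t ^ 3 := one_le_pow₀ ht
  have h4 : rexp (2 * B) ≤ rexp (2 * B) * t ^ 3 := le_mul_of_one_le_right (exp_nonneg _) h3
  refine le_of_mul_le_mul_left ?_ ht0
  linarith

theorem exists_le_exp_neg_two_η {Λ : ℝ} (hΛ : 0 < Λ) (sol : RegularSolution Λ (Ici 1)) :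
    ∃ a, 0 < a ∧ ∀ t, 1 ≤ t → ∀ x, a * t ^ 2 ≤ rexp (-2 * sol.η t x) := by
  obtain ⟨M, hM0, hM⟩ := sol.exists_mul_density_le hΛ
  set T : ℝ := 6 / Λ * (2 * π * M + Λ / 3) + 1 with hT
  have hT1 : 1 ≤ T := by rw [hT]; linarith [show 0 ≤ 6 / Λ * (2 * π * M + Λ / 3) by positivity]
  obtain ⟨B, -, hB⟩ := exists_abs_le_of_periodic sol.η_c1.continuousOn sol.η_per T
  refine ⟨min (Λ / 6) (rexp (-2 * B) / T ^ 2), by positivity, fun t ht x => ?_⟩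
  rcases le_total t T with htT | htT
  · calc min (Λ / 6) (rexp (-2 * B) / T ^ 2) * t ^ 2
        ≤ rexp (-2 * B) / T ^ 2 * T ^ 2 := by gcongr; exact min_le_right _ _
      _ = rexp (-2 * B) := by field_simp
      _ ≤ _ := exp_le_exp.2 (by linarith [le_of_abs_le (hB t ht htT x)])
  · have hmono : MonotoneOn
        (fun τ => τ * rexp (-2 * sol.η τ x) - Λ / 3 * τ ^ 3 + 2 * π * M * τ ^ 2) (Ici 1) := by
      have hd : ∀ τ : ℝ, 1 < τ → HasDerivAt
          (fun τ => τ * rexp (-2 * sol.η τ x) - Λ / 3 * τ ^ 3 + 2 * π * M * τ ^ 2)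
          (4 * π * τ * (M - τ * (sol.r τ x + sol.s τ x))) τ := fun τ hτ =>
        (((sol.hasDerivAt_mul_exp_neg_two_η hτ x).sub
          ((hasDerivAt_pow 3 τ).const_mul (Λ / 3))).add
          ((hasDerivAt_pow 2 τ).const_mul (2 * π * M))).congr_deriv (by push_cast; ring)
      refine monotoneOn_of_deriv_nonneg (convex_Ici 1) ?_ ?_ ?_
      · have := continuousOn_time_slice sol.η_c1 x
        fun_prop
      · rw [interior_Ici]
        exact fun τ hτ => (hd τ hτ).differentiableAt.differentiableWithinAt
      · rw [interior_Ici]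
        intro τ hτ
        rw [(hd τ hτ).deriv]
        have h1 : 0 ≤ M - τ * (sol.r τ x + sol.s τ x) := by linarith [hM τ (le_of_lt hτ) x]
        have h2 : 0 < τ := one_pos.trans hτ
        positivity
    have h := hmono (mem_Ici.2 le_rfl) ht ht
    simp only [one_mul, one_pow, mul_one] at h
    have ht0 : 0 < t := by linarith
    have h0 := exp_pos (-2 * sol.η 1 x)
    have h5 : 2 * π * M + Λ / 3 ≤ Λ / 6 * t := by
      have : Λ / 6 * T = 2 * π * M + Λ / 3 + Λ / 6 := by rw [hT]; field_simp
      have : Λ / 6 * T ≤ Λ / 6 * t := by gcongr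
      linarith
    have h6 : (2 * π * M + Λ / 3) * t ^ 2 ≤ Λ / 6 * t * t ^ 2 := by gcongr
    have h7 : Λ / 3 ≤ Λ / 3 * t ^ 2 := le_mul_of_one_le_right (by positivity) (one_le_pow₀ ht)
    have h8 : 0 ≤ 2 * π * M := by positivity
    refine (mul_le_mul_of_nonneg_right (min_le_left _ _) (sq_nonneg t)).trans ?_
    refine le_of_mul_le_mul_left ?_ ht0
    linarith

theorem exists_abs_η_add_log_le {Λ : ℝ} (hΛ : 0 < Λ) (sol : RegularSolution Λ (Ici 1)) :
    ∃ C, 0 ≤ C ∧ ∀ t, 1 ≤ t → ∀ x, |sol.η t x + log t| ≤ C := by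
  obtain ⟨a, ha, ha'⟩ := sol.exists_le_exp_neg_two_η hΛ
  obtain ⟨b, hb, hb'⟩ := sol.exists_exp_neg_two_η_le hΛ
  refine ⟨|log a| + |log b|, by positivity, fun t ht x => ?_⟩
  have ht0 : 0 < t := by linarith
  have h1 := log_le_log (by positivity) (ha' t ht x)
  have h2 := log_le_log (exp_pos _) (hb' t ht x)
  rw [log_exp, log_mul (by positivity) (by positivity), log_pow] at h1 h2
  push_cast at h1 h2
  have h3 := neg_abs_le (log a)
  have h4 := le_abs_self (log b)
  have h5 := abs_nonneg (log a)
  have h6 := abs_nonneg (log b)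
  rw [abs_le]
  constructor <;> linarith

theorem exists_abs_lam_add_η_le {Λ : ℝ} (hΛ : 0 < Λ) (sol : RegularSolution Λ (Ici 1)) :
    ∃ C, 0 ≤ C ∧ ∀ t, 1 ≤ t → ∀ x, |sol.lam t x + sol.η t x| ≤ C := by
  obtain ⟨a, ha, ha'⟩ := sol.exists_le_exp_neg_two_η hΛ
  obtain ⟨M, hM0, hM⟩ := sol.exists_mul_density_le hΛ
  obtain ⟨A, hA0, hA⟩ := exists_abs_le_of_periodic sol.lam_c1.continuousOn sol.lam_per 1
  obtain ⟨B, hB0, hB⟩ := exists_abs_le_of_periodic sol.η_c1.continuousOn sol.η_per 1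
  set K : ℝ := 4 * π * M / a with hK
  have hK0 : 0 ≤ K := by positivity
  refine ⟨A + B + K, by positivity, fun t ht x => ?_⟩
  have hcont : ContinuousOn (fun τ => sol.lam τ x + sol.η τ x) (Ici 1) :=
    (continuousOn_time_slice sol.lam_c1 x).add (continuousOn_time_slice sol.η_c1 x)
  have hd : ∀ τ : ℝ, 1 < τ → HasDerivAt (fun τ => sol.lam τ x + sol.η τ x)
      (4 * π * rexp (2 * sol.η τ x) * (τ * (sol.r τ x + sol.s τ x))) τ := by
    intro τ hτ
    have hτ0 : 0 < τ := by linarith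
    refine ((hasDerivAt_pderivT sol.lam_c1 hτ x).add
      (hasDerivAt_pderivT sol.η_c1 hτ x)).congr_deriv ?_
    refine mul_left_cancel₀ (show 2 * τ ≠ 0 by positivity) ?_
    linear_combination sol.two_mul_pderivT_lam hτ.le x + sol.two_mul_pderivT_η hτ.le x
  have hnonneg : ∀ τ : ℝ, 1 < τ → 0 ≤ τ * (sol.r τ x + sol.s τ x) := fun τ hτ =>
    mul_nonneg (by linarith)
      (add_nonneg (sol.r_nonneg τ (le_of_lt hτ) x) (sol.s_nonneg τ (le_of_lt hτ) x))
  have hmono : MonotoneOn (fun τ => sol.lam τ x + sol.η τ x) (Ici 1) := by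
    refine monotoneOn_of_deriv_nonneg (convex_Ici 1) hcont ?_ ?_
    · rw [interior_Ici]
      exact fun τ hτ => (hd τ hτ).differentiableAt.differentiableWithinAt
    · rw [interior_Ici]
      intro τ hτ
      rw [(hd τ hτ).deriv]
      have := hnonneg τ hτ
      positivity
  have hanti : AntitoneOn (fun τ => sol.lam τ x + sol.η τ x + K * τ⁻¹) (Ici 1) := by
    have hd' : ∀ τ : ℝ, 1 < τ → HasDerivAt (fun τ => sol.lam τ x + sol.η τ x + K * τ⁻¹)
        (4 * π * rexp (2 * sol.η τ x) * (τ * (sol.r τ x + sol.s τ x)) + K * -(τ ^ 2)⁻¹) τ :=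
      fun τ hτ => (hd τ hτ).add ((hasDerivAt_inv (by linarith)).const_mul K)
    refine antitoneOn_of_deriv_nonpos (convex_Ici 1) ?_ ?_ ?_
    · exact hcont.add (continuousOn_const.mul
        (continuousOn_inv₀.mono fun τ hτ => (one_pos.trans_le hτ).ne'))
    · rw [interior_Ici]
      exact fun τ hτ => (hd' τ hτ).differentiableAt.differentiableWithinAt
    · rw [interior_Ici]
      intro τ hτ
      rw [(hd' τ hτ).deriv]
      have hτ1 : 1 < τ := hτ
      have hτ0 : 0 < τ := by linarith
      have he : rexp (2 * sol.η τ x) ≤ (a * τ ^ 2)⁻¹ := by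
        rw [show 2 * sol.η τ x = -(-2 * sol.η τ x) by ring, exp_neg]
        exact inv_anti₀ (by positivity) (ha' τ hτ1.le x)
      have : 4 * π * rexp (2 * sol.η τ x) * (τ * (sol.r τ x + sol.s τ x))
          ≤ 4 * π * (a * τ ^ 2)⁻¹ * M := by
        have := hnonneg τ hτ1
        have := hM τ hτ1.le x
        gcongr
      have hKe : K * (τ ^ 2)⁻¹ = 4 * π * (a * τ ^ 2)⁻¹ * M := by
        rw [hK]; field_simp
      linarith
  have h1 := hmono (mem_Ici.2 le_rfl) ht ht
  have h2 := hanti (mem_Ici.2 le_rfl) ht ht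
  simp only [inv_one, mul_one] at h1 h2
  have h3 : 0 ≤ K * t⁻¹ := mul_nonneg hK0 (inv_nonneg.2 (by linarith))
  have h4 := abs_le.1 (hA 1 le_rfl le_rfl x)
  have h5 := abs_le.1 (hB 1 le_rfl le_rfl x)
  rw [abs_le]
  constructor <;> linarith [h4.1, h4.2, h5.1, h5.2]

end RegularSolution

/-- Logarithmic asymptotics of the metric coefficients (Theorem 4.1). -/
theorem metric_log_asymptotics (Λ : ℝ) (hΛ : 0 < Λ)
    (sol : RegularSolution Λ (Set.Ici 1)) :
    ∃ C : ℝ, 0 < C ∧ ∀ t : ℝ, 1 ≤ t → ∀ x : ℝ,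
      |sol.η t x + Real.log t| ≤ C ∧ |sol.lam t x - Real.log t| ≤ C := by
  obtain ⟨C, hC0, hC⟩ := sol.exists_abs_η_add_log_le hΛ
  obtain ⟨D, hD0, hD⟩ := sol.exists_abs_lam_add_η_le hΛ
  refine ⟨C + D + 1, by positivity, fun t ht x => ?_⟩
  have h1 := abs_le.1 (hC t ht x)
  have h2 := abs_le.1 (hD t ht x)
  refine ⟨abs_le.2 ⟨by linarith [h1.1], by linarith [h1.2]⟩,
    abs_le.2 ⟨by linarith [h1.2, h2.1], by linarith [h1.1, h2.2]⟩⟩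
end
end

section
/- (Uniform boundedness of ∂ₓη, Theorem 4.1.) Let (η, λ, r, s) be a regular solution on [1,∞). Then there exists a constant C > 0 such that for every t ≥ 1 and every x ∈ ℝ: |∂ₓη(t,x)| ≤ C. -/
open Real Set MeasureTheory

noncomputable section

/-- A function on `[1, ∞) × ℝ` that is continuous and 1-periodic in the second variable is bounded
on every slab `[1, b] × ℝ`. -/
lemma exists_slab_bound {f : ℝ → ℝ → ℝ}
    (hf : ContinuousOn (fun p : ℝ × ℝ => f p.1 p.2) (Set.Ici 1 ×ˢ (Set.univ : Set ℝ)))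
    (hper : ∀ t ∈ Set.Ici (1 : ℝ), ∀ x : ℝ, f t (x + 1) = f t x) (b : ℝ) :
    ∃ M : ℝ, 0 ≤ M ∧ ∀ t ∈ Set.Icc 1 b, ∀ x : ℝ, |f t x| ≤ M := by
  have hK : IsCompact (Set.Icc (1 : ℝ) b ×ˢ Set.Icc (0 : ℝ) 1) := isCompact_Icc.prod isCompact_Icc
  obtain ⟨M, hM⟩ := hK.exists_bound_of_continuousOn
    (hf.mono (Set.prod_mono Set.Icc_subset_Ici_self (Set.subset_univ _)))
  refine ⟨max M 0, le_max_right _ _, fun t ht x => ?_⟩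
  have hp : Function.Periodic (f t) 1 := hper t ht.1
  obtain ⟨y, hy, hxy⟩ := hp.exists_mem_Ico₀ one_pos x
  rw [hxy]
  exact (hM (t, y) ⟨ht, hy.1, hy.2.le⟩).trans (le_max_left _ _)

/-- Maximum principle for the transport inequality `∂ₜF + c ∂ₓF ≤ 0` with 1-periodic `F`. -/
lemma transport_le_of_initial_le {F Ft Fx c : ℝ → ℝ → ℝ} {t₀ t₁ M : ℝ} (h01 : t₀ ≤ t₁)
    (hF : ContinuousOn (fun p : ℝ × ℝ => F p.1 p.2) (Set.Icc t₀ t₁ ×ˢ (Set.univ : Set ℝ)))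
    (hper : ∀ t ∈ Set.Icc t₀ t₁, ∀ x : ℝ, F t (x + 1) = F t x)
    (ht : ∀ t ∈ Set.Ioc t₀ t₁, ∀ x, HasDerivAt (fun τ => F τ x) (Ft t x) t)
    (hx : ∀ t ∈ Set.Ioc t₀ t₁, ∀ x, HasDerivAt (fun y => F t y) (Fx t x) x)
    (hle : ∀ t ∈ Set.Ioc t₀ t₁, ∀ x, Ft t x + c t x * Fx t x ≤ 0)
    (hinit : ∀ x, F t₀ x ≤ M) (x : ℝ) : F t₁ x ≤ M := by
  by_contra! hlt
  obtain ⟨ε, hε, hεM⟩ : ∃ ε > 0, M < F t₁ x - ε * (t₁ - t₀) := by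
    refine ⟨(F t₁ x - M) / (2 * (t₁ - t₀ + 1)), by apply div_pos <;> linarith, ?_⟩
    have h : (F t₁ x - M) / (2 * (t₁ - t₀ + 1)) * (t₁ - t₀) < F t₁ x - M := by
      rw [div_mul_eq_mul_div, div_lt_iff₀ (by linarith)]
      nlinarith
    linarith
  have hred : ∀ t ∈ Set.Icc t₀ t₁, ∀ y, ∃ z ∈ Set.Icc (0 : ℝ) 1, F t y = F t z := by
    intro t ht' y
    have hp : Function.Periodic (F t) 1 := hper t ht'
    obtain ⟨z, hz, hyz⟩ := hp.exists_mem_Ico₀ one_pos y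
    exact ⟨z, ⟨hz.1, hz.2.le⟩, hyz⟩
  have hK : IsCompact (Set.Icc t₀ t₁ ×ˢ Set.Icc (0 : ℝ) 1) := isCompact_Icc.prod isCompact_Icc
  obtain ⟨⟨τ, y⟩, ⟨hτ, -⟩, hmax⟩ := hK.exists_isMaxOn
    ⟨(t₀, 0), ⟨le_rfl, h01⟩, le_rfl, zero_le_one⟩
    (f := fun p : ℝ × ℝ => F p.1 p.2 - ε * (p.1 - t₀))
    ((hF.mono (Set.prod_mono le_rfl (Set.subset_univ _))).sub (by fun_prop))
  have hmax' : ∀ t ∈ Set.Icc t₀ t₁, ∀ z, F t z - ε * (t - t₀) ≤ F τ y - ε * (τ - t₀) := by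
    intro t ht' z
    obtain ⟨z', hz', hzz⟩ := hred t ht' z
    rw [hzz]
    exact hmax (show (t, z') ∈ _ from ⟨ht', hz'⟩)
  have hτ0 : t₀ < τ := by
    rcases hτ.1.eq_or_lt with h | h
    · have h1 := hmax' t₁ ⟨h01, le_rfl⟩ x
      have h2 := hinit y
      have h' : t₀ = τ := h
      rw [← h', sub_self, mul_zero, sub_zero] at h1
      linarith
    · exact h
  have hτ' : τ ∈ Set.Ioc t₀ t₁ := ⟨hτ0, hτ.2⟩
  have hFx : Fx τ y = 0 := by
    refine IsLocalMax.hasDerivAt_eq_zero (Filter.Eventually.of_forall fun z => ?_) (hx τ hτ' y)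
    linarith [hmax' τ hτ z]
  have hFt : Ft τ y ≤ 0 := by simpa [hFx] using hle τ hτ' y
  have hd : HasDerivAt (fun t => F t y - ε * (t - t₀)) (Ft τ y - ε) τ := by
    simpa using (ht τ hτ' y).fun_sub (((hasDerivAt_id' τ).sub_const t₀).const_mul ε)
  have hneg : Ft τ y - ε < 0 := by linarith
  have hev := (hasDerivAt_iff_tendsto_slope.1 hd).eventually (gt_mem_nhds hneg)
  have hev' := hev.filter_mono (nhdsWithin_mono τ (fun z hz => ne_of_lt hz : Set.Iio τ ⊆ {τ}ᶜ))
  obtain ⟨z, hz, hzI⟩ := (hev'.and (Ioo_mem_nhdsLT hτ0)).exists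
  rw [slope_def_field, div_lt_iff_of_neg (by linarith [hzI.2])] at hz
  have := hmax' z ⟨hzI.1.le, hzI.2.le.trans hτ.2⟩ y
  linarith

/-- Continuously differentiable functions on `[1, ∞) × ℝ` have partial derivatives for `t > 1`. -/
lemma hasDerivAt_partials {f : ℝ → ℝ → ℝ}
    (hf : ContDiffOn ℝ 1 (fun p : ℝ × ℝ => f p.1 p.2) (Set.Ici 1 ×ˢ (Set.univ : Set ℝ)))
    {t : ℝ} (ht : 1 < t) (x : ℝ) :
    HasDerivAt (fun τ => f τ x) (pderivT f t x) t ∧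
      HasDerivAt (fun y => f t y) (pderivX f t x) x := by
  have hd : DifferentiableAt ℝ (fun p : ℝ × ℝ => f p.1 p.2) (t, x) :=
    (hf.differentiableOn one_ne_zero).differentiableAt
      (prod_mem_nhds (Ici_mem_nhds ht) Filter.univ_mem)
  constructor
  · exact (DifferentiableAt.comp (f := fun τ : ℝ => (τ, x)) t hd (by fun_prop)).hasDerivAt
  · exact (DifferentiableAt.comp (f := fun y : ℝ => (t, y)) x hd (by fun_prop)).hasDerivAt

/-- Restriction of a jointly continuous function to a line of constant `x`. -/
lemma continuousOn_time {f : ℝ → ℝ → ℝ}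
    (hf : ContinuousOn (fun p : ℝ × ℝ => f p.1 p.2) (Set.Ici 1 ×ˢ (Set.univ : Set ℝ))) (x : ℝ) :
    ContinuousOn (fun t => f t x) (Set.Ici 1) :=
  hf.comp (f := fun t : ℝ => (t, x)) (by fun_prop) (fun _ ht => ⟨ht, Set.mem_univ _⟩)

namespace RegularSolution

variable {Λ : ℝ}

/-- The evolution equation (E1) solved for `t ∂ₜλ`. -/
lemma mul_pderivT_lam (sol : RegularSolution Λ (Set.Ici 1)) {t : ℝ} (ht : 1 ≤ t) (x : ℝ) :
    2 * t * pderivT sol.lam t x = -1 + Real.exp (2 * sol.η t x) *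
      (Λ * t ^ 2 + 4 * Real.pi * t ^ 2 * (sol.r t x + sol.s t x)) := by
  have h := sol.eqE1 t ht x
  have hE : Real.exp (2 * sol.η t x) * Real.exp (-2 * sol.η t x) = 1 := by
    rw [← Real.exp_add]; simp
  linear_combination Real.exp (2 * sol.η t x) * h - (2 * t * pderivT sol.lam t x + 1) * hE

/-- The evolution equation (E2) solved for `t ∂ₜη`. -/
lemma mul_pderivT_η (sol : RegularSolution Λ (Set.Ici 1)) {t : ℝ} (ht : 1 ≤ t) (x : ℝ) :
    2 * t * pderivT sol.η t x = 1 + Real.exp (2 * sol.η t x) *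
      (-(Λ * t ^ 2) + 4 * Real.pi * t ^ 2 * (sol.r t x + sol.s t x)) := by
  have h := sol.eqE2 t ht x
  have hE : Real.exp (2 * sol.η t x) * Real.exp (-2 * sol.η t x) = 1 := by
    rw [← Real.exp_add]; simp
  linear_combination Real.exp (2 * sol.η t x) * h - (2 * t * pderivT sol.η t x - 1) * hE

/-- Along lines of constant `x`, `t e^{-2η}` satisfies a linear evolution equation. -/
lemma hasDerivAt_mul_exp_neg (sol : RegularSolution Λ (Set.Ici 1)) {t : ℝ} (ht : 1 < t) (x : ℝ) :
    HasDerivAt (fun τ => τ * Real.exp (-2 * sol.η τ x))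
      (Λ * t ^ 2 - 4 * Real.pi * t ^ 2 * (sol.r t x + sol.s t x)) t := by
  have h := sol.eqE2 t ht.le x
  refine ((hasDerivAt_id' t).fun_mul
    (((hasDerivAt_partials sol.η_c1 ht x).1.const_mul (-2)).exp)).congr_deriv ?_
  linear_combination -h

/-- Uniform lower bound `2 ≤ Λ t² e^{2η}` for large times. -/
lemma exists_two_le (sol : RegularSolution Λ (Set.Ici 1)) (hΛ : 0 < Λ) :
    ∃ t₀ : ℝ, 2 ≤ t₀ ∧ ∀ t, t₀ ≤ t → ∀ x, 2 ≤ Λ * t ^ 2 * Real.exp (2 * sol.η t x) := by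
  obtain ⟨M, hM0, hM⟩ := exists_slab_bound sol.η_c1.continuousOn sol.η_per 1
  set K := Real.exp (2 * M) with hK
  have hKpos : 0 < K := Real.exp_pos _
  refine ⟨2 + 6 * K / Λ, by linarith [show 0 < 6 * K / Λ by positivity], fun t ht x => ?_⟩
  have ht2 : 2 ≤ t := by linarith [show 0 < 6 * K / Λ by positivity]
  have hKt : 6 * K ≤ Λ * t := by
    have : 6 * K / Λ ≤ t := by linarith
    rw [div_le_iff₀ hΛ] at this
    linarith
  have hanti : AntitoneOn (fun τ => τ * Real.exp (-2 * sol.η τ x) - Λ * τ ^ 3 / 3)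
      (Set.Ici 1) := by
    have hd : ∀ τ, 1 < τ → HasDerivAt
        (fun τ => τ * Real.exp (-2 * sol.η τ x) - Λ * τ ^ 3 / 3)
        (-(4 * Real.pi * τ ^ 2 * (sol.r τ x + sol.s τ x))) τ := by
      intro τ hτ
      refine ((sol.hasDerivAt_mul_exp_neg hτ x).fun_sub
        (((hasDerivAt_pow 3 τ).const_mul Λ).div_const 3)).congr_deriv ?_
      push_cast; ring
    refine antitoneOn_of_deriv_nonpos (convex_Ici 1) ?_ ?_ ?_
    · have := continuousOn_time sol.η_c1.continuousOn x
      fun_prop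
    · rw [interior_Ici]
      exact fun τ hτ => (hd τ hτ).differentiableAt.differentiableWithinAt
    · rw [interior_Ici]
      intro τ hτ
      have hτ' : (1 : ℝ) ≤ τ := le_of_lt hτ
      rw [(hd τ hτ).deriv, neg_nonpos]
      have h1 := sol.r_nonneg τ hτ' x
      have h2 := sol.s_nonneg τ hτ' x
      positivity
  have h1 := hanti (Set.mem_Ici.2 le_rfl) (Set.mem_Ici.2 (by linarith)) (show 1 ≤ t by linarith)
  have h2 : Real.exp (-2 * sol.η 1 x) ≤ K := by
    apply Real.exp_le_exp.2
    linarith [neg_abs_le (sol.η 1 x), hM 1 ⟨le_rfl, le_rfl⟩ x]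
  set v := Real.exp (-2 * sol.η t x) with hv
  have hvE : v * Real.exp (2 * sol.η t x) = 1 := by
    rw [hv, ← Real.exp_add]; simp
  have h3 : t * v ≤ Λ * t ^ 3 / 3 + K := by
    simp only [one_pow, one_mul] at h1
    nlinarith
  have h4 : K ≤ Λ * t ^ 3 / 6 := by
    have : Λ * t ≤ Λ * t ^ 3 := by
      apply mul_le_mul_of_nonneg_left _ hΛ.le
      nlinarith [sq_nonneg t, mul_self_nonneg (t - 1)]
    linarith
  have h5 : 2 * v ≤ Λ * t ^ 2 := by
    have : t * (2 * v) ≤ t * (Λ * t ^ 2) := by linarith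
    exact le_of_mul_le_mul_left this (by linarith)
  have hE := Real.exp_pos (2 * sol.η t x)
  calc (2 : ℝ) = 2 * v * Real.exp (2 * sol.η t x) := by linear_combination -2 * hvE
    _ ≤ _ := mul_le_mul_of_nonneg_right h5 hE.le

/-- Decay of a null component `f` of the fluid energy transported with speed `c`. -/
lemma exists_decay (sol : RegularSolution Λ (Set.Ici 1)) {f c : ℝ → ℝ → ℝ}
    (hf : ContDiffOn ℝ 1 (fun p : ℝ × ℝ => f p.1 p.2) (Set.Ici 1 ×ˢ (Set.univ : Set ℝ)))
    (hper : ∀ t ∈ Set.Ici (1 : ℝ), ∀ x : ℝ, f t (x + 1) = f t x)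
    (hpos : ∀ t ∈ Set.Ici (1 : ℝ), ∀ x : ℝ, 0 ≤ f t x)
    (hle : ∀ t ∈ Set.Ici (1 : ℝ), ∀ x : ℝ, pderivT f t x + c t x * pderivX f t x ≤
      -2 * (pderivT sol.lam t x + c t x * pderivX sol.η t x + 1 / t) * f t x)
    {t₀ : ℝ} (ht₀ : 2 ≤ t₀)
    (h2 : ∀ t, t₀ ≤ t → ∀ x, 2 ≤ Λ * t ^ 2 * Real.exp (2 * sol.η t x)) :
    ∃ M : ℝ, 0 ≤ M ∧ ∀ t, t₀ ≤ t → ∀ x, t ^ 4 * (f t x * Real.exp (2 * sol.η t x)) ≤ M := by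
  have hcf := hf.continuousOn
  have hcη := sol.η_c1.continuousOn
  have hcont : ContinuousOn (fun p : ℝ × ℝ => p.1 ^ 4 * (f p.1 p.2 *
      Real.exp (2 * sol.η p.1 p.2))) (Set.Ici 1 ×ˢ (Set.univ : Set ℝ)) := by
    fun_prop
  have hFper : ∀ t ∈ Set.Ici (1 : ℝ), ∀ x : ℝ,
      t ^ 4 * (f t (x + 1) * Real.exp (2 * sol.η t (x + 1))) =
        t ^ 4 * (f t x * Real.exp (2 * sol.η t x)) := by
    intro t ht x
    rw [hper t ht, sol.η_per t ht]
  obtain ⟨M, hM0, hM⟩ := exists_slab_bound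
    (f := fun t x => t ^ 4 * (f t x * Real.exp (2 * sol.η t x))) hcont hFper t₀
  refine ⟨M, hM0, fun t ht x => ?_⟩
  refine transport_le_of_initial_le (F := fun t x => t ^ 4 * (f t x * Real.exp (2 * sol.η t x)))
    (c := c)
    (Ft := fun t x => 4 * t ^ 3 * (f t x * Real.exp (2 * sol.η t x)) + t ^ 4 *
      (pderivT f t x * Real.exp (2 * sol.η t x) +
        f t x * (Real.exp (2 * sol.η t x) * (2 * pderivT sol.η t x))))
    (Fx := fun t x => t ^ 4 * (pderivX f t x * Real.exp (2 * sol.η t x) +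
        f t x * (Real.exp (2 * sol.η t x) * (2 * pderivX sol.η t x))))
    ht (hcont.mono (Set.prod_mono (fun τ hτ => ?_) le_rfl)) (fun τ hτ => hFper τ ?_)
    (fun τ hτ y => ?_) (fun τ hτ y => ?_) (fun τ hτ y => ?_)
    (fun y => (le_abs_self _).trans (hM t₀ ⟨by linarith, le_rfl⟩ y)) x
  · exact Set.mem_Ici.2 (by linarith [hτ.1])
  · exact Set.mem_Ici.2 (by linarith [hτ.1])
  · have hτ1 : 1 < τ := by linarith [hτ.1]
    refine ((hasDerivAt_pow 4 τ).fun_mul ((hasDerivAt_partials hf hτ1 y).1.fun_mul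
      (((hasDerivAt_partials sol.η_c1 hτ1 y).1.const_mul 2).exp))).congr_deriv ?_
    push_cast; ring
  · have hτ1 : 1 < τ := by linarith [hτ.1]
    exact ((hasDerivAt_partials hf hτ1 y).2.fun_mul
      (((hasDerivAt_partials sol.η_c1 hτ1 y).2.const_mul 2).exp)).const_mul _
  · have hτ1 : 1 ≤ τ := by linarith [hτ.1]
    have hl := hle τ hτ1 y
    have h2' := h2 τ hτ.1.le y
    have hL := sol.mul_pderivT_lam hτ1 y
    have hN := sol.mul_pderivT_η hτ1 y
    have hf0 := hpos τ hτ1 y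
    have hτt : τ * (1 / τ) = 1 := by field_simp
    set E := Real.exp (2 * sol.η τ y)
    have hE : 0 < E := Real.exp_pos _
    have ha : 0 ≤ τ ^ 4 * E := by positivity
    have hb : 0 ≤ τ ^ 3 * E * f τ y := by positivity
    have hl' := mul_le_mul_of_nonneg_left hl ha
    have hm := mul_nonneg hb (sub_nonneg.2 h2')
    linear_combination hl' + 2 * hm + τ ^ 3 * E * f τ y * hN - τ ^ 3 * E * f τ y * hL
      - 2 * τ ^ 3 * E * f τ y * hτt

/-- Eventual upper bound `Λ t² e^{2η} ≤ 4`, given decay of the fluid energy. -/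
lemma exists_le_four (sol : RegularSolution Λ (Set.Ici 1)) (hΛ : 0 < Λ) {t₀ M : ℝ} (ht₀ : 2 ≤ t₀)
    (hM0 : 0 ≤ M)
    (h2 : ∀ t, t₀ ≤ t → ∀ x, 2 ≤ Λ * t ^ 2 * Real.exp (2 * sol.η t x))
    (hM : ∀ t, t₀ ≤ t → ∀ x,
      t ^ 4 * ((sol.r t x + sol.s t x) * Real.exp (2 * sol.η t x)) ≤ M) :
    ∃ t₁ : ℝ, t₀ ≤ t₁ ∧ ∀ t, t₁ ≤ t → ∀ x, Λ * t ^ 2 * Real.exp (2 * sol.η t x) ≤ 4 := by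
  set K := 2 * Real.pi * Λ * M with hK
  have hK0 : 0 ≤ K := by have := Real.pi_pos; positivity
  set B := 12 * (K + Λ * t₀ ^ 3 / 3) / Λ with hB
  have hB0 : 0 ≤ B := by positivity
  refine ⟨t₀ + B, by linarith, fun t ht x => ?_⟩
  have htt : t₀ ≤ t := by linarith
  have hmono : MonotoneOn
      (fun τ => τ * Real.exp (-2 * sol.η τ x) - Λ * τ ^ 3 / 3 + K * τ) (Set.Ici t₀) := by
    have hd : ∀ τ, t₀ < τ → HasDerivAt
        (fun τ => τ * Real.exp (-2 * sol.η τ x) - Λ * τ ^ 3 / 3 + K * τ)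
        (K - 4 * Real.pi * τ ^ 2 * (sol.r τ x + sol.s τ x)) τ := by
      intro τ hτ
      refine (((sol.hasDerivAt_mul_exp_neg (by linarith) x).fun_sub
        (((hasDerivAt_pow 3 τ).const_mul Λ).div_const 3)).fun_add
          ((hasDerivAt_id' τ).const_mul K)).congr_deriv ?_
      push_cast; ring
    refine monotoneOn_of_deriv_nonneg (convex_Ici t₀) ?_ ?_ ?_
    · have := (continuousOn_time sol.η_c1.continuousOn x).mono
        (Set.Ici_subset_Ici.2 (show 1 ≤ t₀ by linarith))
      fun_prop
    · rw [interior_Ici]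
      exact fun τ hτ => (hd τ hτ).differentiableAt.differentiableWithinAt
    · rw [interior_Ici]
      intro τ hτ
      have hτ' : t₀ ≤ τ := le_of_lt hτ
      have hτ1 : 1 ≤ τ := by linarith
      rw [(hd τ hτ).deriv, sub_nonneg]
      have h1 := sol.r_nonneg τ hτ1 x
      have h2' := h2 τ hτ' x
      have h3 := sol.s_nonneg τ hτ1 x
      have h4 := hM τ hτ' x
      have hA : 0 ≤ 2 * Real.pi * τ ^ 2 * (sol.r τ x + sol.s τ x) := by positivity
      have hC : 0 ≤ 2 * Real.pi * Λ := by positivity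
      have h5 := mul_le_mul_of_nonneg_left h2' hA
      have h6 := mul_le_mul_of_nonneg_left h4 hC
      rw [hK]
      linear_combination h5 + h6
  have h1 := hmono (Set.mem_Ici.2 le_rfl) (Set.mem_Ici.2 htt) htt
  have hv0 := Real.exp_pos (-2 * sol.η t₀ x)
  set v := Real.exp (-2 * sol.η t x) with hv
  have hvE : v * Real.exp (2 * sol.η t x) = 1 := by
    rw [hv, ← Real.exp_add]; simp
  have h3 : Λ * t ^ 3 / 3 - K * t - Λ * t₀ ^ 3 / 3 ≤ t * v := by
    simp only at h1
    have : 0 ≤ t₀ * Real.exp (-2 * sol.η t₀ x) := by positivity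
    have : 0 ≤ K * t₀ := by positivity
    linarith
  have h4 : K * t + Λ * t₀ ^ 3 / 3 ≤ Λ * t ^ 3 / 12 := by
    have hBt : B ≤ t := by linarith
    rw [hB, div_le_iff₀ hΛ] at hBt
    have ht1 : 1 ≤ t := by linarith
    have h5 : K * t + Λ * t₀ ^ 3 / 3 ≤ (K + Λ * t₀ ^ 3 / 3) * t := by
      have : 0 ≤ Λ * t₀ ^ 3 / 3 := by positivity
      nlinarith
    have h6 : (K + Λ * t₀ ^ 3 / 3) * t ≤ Λ * t ^ 2 / 12 := by nlinarith
    have h7 : Λ * t ^ 2 ≤ Λ * t ^ 3 :=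
      mul_le_mul_of_nonneg_left (pow_le_pow_right₀ ht1 (by norm_num)) hΛ.le
    linarith
  have h5 : Λ * t ^ 2 ≤ 4 * v := by
    have : t * (Λ * t ^ 2) ≤ t * (4 * v) := by linarith
    exact le_of_mul_le_mul_left this (by linarith)
  have hE := Real.exp_pos (2 * sol.η t x)
  calc _ ≤ 4 * v * Real.exp (2 * sol.η t x) := mul_le_mul_of_nonneg_right h5 hE.le
    _ = 4 := by linear_combination 4 * hvE

/-- Growth bound `e^{λ-η} ≤ C t³` for large times. -/
lemma exists_exp_sub_le (sol : RegularSolution Λ (Set.Ici 1)) {t₁ : ℝ} (ht₁ : 2 ≤ t₁)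
    (h4 : ∀ t, t₁ ≤ t → ∀ x, Λ * t ^ 2 * Real.exp (2 * sol.η t x) ≤ 4) :
    ∃ C : ℝ, 0 ≤ C ∧ ∀ t, t₁ ≤ t → ∀ x,
      Real.exp (sol.lam t x - sol.η t x) ≤ C * t ^ 3 := by
  obtain ⟨A, -, hA⟩ := exists_slab_bound sol.η_c1.continuousOn sol.η_per t₁
  obtain ⟨B, -, hB⟩ := exists_slab_bound sol.lam_c1.continuousOn sol.lam_per t₁
  refine ⟨Real.exp (A + B), (Real.exp_pos _).le, fun t ht x => ?_⟩
  have hanti : AntitoneOn (fun τ => sol.lam τ x - sol.η τ x - 3 * Real.log τ) (Set.Ici t₁) := by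
    have hd : ∀ τ, t₁ < τ → HasDerivAt (fun τ => sol.lam τ x - sol.η τ x - 3 * Real.log τ)
        (pderivT sol.lam τ x - pderivT sol.η τ x - 3 * τ⁻¹) τ := by
      intro τ hτ
      have hτ1 : 1 < τ := by linarith
      exact ((hasDerivAt_partials sol.lam_c1 hτ1 x).1.fun_sub
        (hasDerivAt_partials sol.η_c1 hτ1 x).1).fun_sub
          ((Real.hasDerivAt_log (by linarith)).const_mul 3)
    have hsub : Set.Ici t₁ ⊆ Set.Ici (1 : ℝ) := Set.Ici_subset_Ici.2 (by linarith)
    refine antitoneOn_of_deriv_nonpos (convex_Ici t₁) ?_ ?_ ?_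
    · refine (((continuousOn_time sol.lam_c1.continuousOn x).mono hsub).sub
        ((continuousOn_time sol.η_c1.continuousOn x).mono hsub)).sub
          (continuousOn_const.mul (Real.continuousOn_log.mono fun τ hτ => ?_))
      have : t₁ ≤ τ := hτ
      exact (show (0 : ℝ) < τ by linarith).ne'
    · rw [interior_Ici]
      exact fun τ hτ => (hd τ hτ).differentiableAt.differentiableWithinAt
    · rw [interior_Ici]
      intro τ hτ
      have hτ' : t₁ ≤ τ := le_of_lt hτ
      have hτ1 : 1 ≤ τ := by linarith
      rw [(hd τ hτ).deriv]
      have hL := sol.mul_pderivT_lam hτ1 x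
      have hN := sol.mul_pderivT_η hτ1 x
      have hE := h4 τ hτ' x
      have hτt : τ * τ⁻¹ = 1 := mul_inv_cancel₀ (by linarith)
      have : 2 * τ * (pderivT sol.lam τ x - pderivT sol.η τ x - 3 * τ⁻¹) ≤ 0 := by
        linear_combination 2 * hE + hL - hN - 6 * hτt
      exact nonpos_of_mul_nonpos_right this (by linarith)
  have h1 := hanti (Set.mem_Ici.2 le_rfl) (Set.mem_Ici.2 ht) ht
  have ht1 : t₁ ∈ Set.Icc 1 t₁ := ⟨by linarith, le_rfl⟩
  have hlog : 0 ≤ Real.log t₁ := Real.log_nonneg (by linarith)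
  have h2 : sol.lam t x - sol.η t x ≤ A + B + 3 * Real.log t := by
    simp only at h1
    linarith [neg_abs_le (sol.η t₁ x), le_abs_self (sol.lam t₁ x), hA t₁ ht1 x, hB t₁ ht1 x]
  calc _ ≤ Real.exp (A + B + 3 * Real.log t) := Real.exp_le_exp.2 h2
    _ = Real.exp (A + B) * t ^ 3 := by
      rw [Real.exp_add, show 3 * Real.log t = ((3 : ℕ) : ℝ) * Real.log t by norm_num,
        Real.exp_nat_mul, Real.exp_log (by linarith)]

/-- `∂ₓη` is bounded on compact time intervals. -/
lemma exists_pderivX_η_bound (sol : RegularSolution Λ (Set.Ici 1)) (b : ℝ) :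
    ∃ C : ℝ, 0 ≤ C ∧ ∀ t ∈ Set.Icc 1 b, ∀ x, |pderivX sol.η t x| ≤ C := by
  have hη := sol.η_c1.continuousOn
  have hlam := sol.lam_c1.continuousOn
  have hr := sol.r_c1.continuousOn
  have hs := sol.s_c1.continuousOn
  obtain ⟨C, hC0, hC⟩ := exists_slab_bound (b := b)
    (f := fun t x => -(2 * Real.pi * t * Real.exp (sol.lam t x + sol.η t x) *
      (sol.r t x - sol.s t x))) (by fun_prop)
    (fun t ht x => by
      simp only [sol.lam_per t ht, sol.η_per t ht, sol.r_per t ht, sol.s_per t ht])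
  refine ⟨C, hC0, fun t ht x => ?_⟩
  rw [sol.eqE3 t ht.1 x]
  exact hC t ht x

end RegularSolution

/-- Uniform boundedness of `∂ₓη` (Theorem 4.1). -/
theorem eta_x_bounded (Λ : ℝ) (hΛ : 0 < Λ)
    (sol : RegularSolution Λ (Set.Ici 1)) :
    ∃ C : ℝ, 0 < C ∧ ∀ t : ℝ, 1 ≤ t → ∀ x : ℝ, |pderivX sol.η t x| ≤ C := by
  obtain ⟨t₀, ht₀, h2⟩ := sol.exists_two_le hΛ
  have hsqrt : ∀ t ∈ Set.Ici (1 : ℝ), ∀ x, 0 ≤ 2 / t * Real.sqrt (sol.r t x * sol.s t x) := by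
    intro t ht x
    have ht' : (1 : ℝ) ≤ t := ht
    positivity
  obtain ⟨M₁, hM₁, hr⟩ := sol.exists_decay (c := fun t x => Real.exp (sol.η t x - sol.lam t x))
    sol.r_c1 sol.r_per sol.r_nonneg
    (fun t ht x => by linarith [sol.eqE4 t ht x, hsqrt t ht x]) ht₀ h2
  obtain ⟨M₂, hM₂, hs⟩ := sol.exists_decay (c := fun t x => -Real.exp (sol.η t x - sol.lam t x))
    sol.s_c1 sol.s_per sol.s_nonneg
    (fun t ht x => by linear_combination sol.eqE5 t ht x + hsqrt t ht x) ht₀ h2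
  have hrs : ∀ t, t₀ ≤ t → ∀ x,
      t ^ 4 * ((sol.r t x + sol.s t x) * Real.exp (2 * sol.η t x)) ≤ M₁ + M₂ := by
    intro t ht x
    linarith [hr t ht x, hs t ht x]
  obtain ⟨t₁, ht₁, h4⟩ := sol.exists_le_four hΛ ht₀ (add_nonneg hM₁ hM₂) h2 hrs
  obtain ⟨K, hK, hexp⟩ := sol.exists_exp_sub_le (ht₀.trans ht₁) h4
  obtain ⟨C, hC, hCb⟩ := sol.exists_pderivX_η_bound t₁
  have hKM : 0 ≤ 2 * Real.pi * K * (M₁ + M₂) := by positivity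
  refine ⟨C + 2 * Real.pi * K * (M₁ + M₂) + 1, by linarith, fun t ht x => ?_⟩
  rcases le_total t t₁ with h | h
  · linarith [hCb t ⟨ht, h⟩ x]
  have hr0 := sol.r_nonneg t ht x
  have hs0 := sol.s_nonneg t ht x
  have hsplit : Real.exp (sol.lam t x + sol.η t x) =
      Real.exp (sol.lam t x - sol.η t x) * Real.exp (2 * sol.η t x) := by
    rw [← Real.exp_add]; ring_nf
  have habs : |sol.r t x - sol.s t x| ≤ sol.r t x + sol.s t x :=
    abs_le.2 ⟨by linarith, by linarith⟩
  have hpre : 0 ≤ 2 * Real.pi * t * Real.exp (sol.lam t x + sol.η t x) := by positivity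
  have hmain : |pderivX sol.η t x| ≤ 2 * Real.pi * K * (M₁ + M₂) := by
    rw [sol.eqE3 t ht x, abs_neg, abs_mul, abs_of_nonneg hpre]
    calc _ ≤ 2 * Real.pi * t * Real.exp (sol.lam t x + sol.η t x) * (sol.r t x + sol.s t x) :=
          mul_le_mul_of_nonneg_left habs hpre
      _ = 2 * Real.pi * t * ((sol.r t x + sol.s t x) * Real.exp (2 * sol.η t x)) *
          Real.exp (sol.lam t x - sol.η t x) := by rw [hsplit]; ring
      _ ≤ 2 * Real.pi * t * ((sol.r t x + sol.s t x) * Real.exp (2 * sol.η t x)) *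
          (K * t ^ 3) := mul_le_mul_of_nonneg_left (hexp t h x) (by positivity)
      _ = 2 * Real.pi * K *
          (t ^ 4 * ((sol.r t x + sol.s t x) * Real.exp (2 * sol.η t x))) := by ring
      _ ≤ _ := mul_le_mul_of_nonneg_left (hrs t (ht₁.trans h) x) (by positivity)
  linarith
end
end
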